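/- arXiv:2304.14380 — 6 statements merged into one kernel-verified Lean document; each statement's English description precedes it below -/
import Mathlib

section
/- Fix t > 0 and h ≥ 0, and define f : ℝ → ℝ by f(x) = h − √(2h/t)·|x| for |x| ≤ √(2th) and f(x) = −x²/(2t) for |x| > √(2th). Then f is continuous, f is differentiable at every x outside the finite set {0, √(2th), −√(2th)}, the function x ↦ ½·f′(x)² − ½·(x/t)² (defined off that finite set, extended arbitrarily on it) is integrable on ℝ, and ∫_ℝ (½·f′(x)² − ½·(x/t)²) dx = (4/3)·(2/t)^{1/2}·h^{3/2}. -/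
open MeasureTheory Real

/-- The one-point KPZ rate function computation.
For `t > 0`, `h ≥ 0`, the optimal profile `f(x) = h − √(2h/t)·|x|` for `|x| ≤ √(2th)`
and `f(x) = −x²/(2t)` for `|x| > √(2th)` is continuous, differentiable off
`{0, √(2th), −√(2th)}`, the integrand `½ f'(x)² − ½ (x/t)²` is integrable,
and its integral is `(4/3)·(2/t)^{1/2}·h^{3/2}`. -/
theorem stmt_0 (t h : ℝ) (ht : 0 < t) (hh : 0 ≤ h)
    (f : ℝ → ℝ)
    (hf : ∀ x : ℝ, f x =
      if |x| ≤ Real.sqrt (2*t*h) then h - Real.sqrt (2*h/t) * |x| else -x^2/(2*t)) :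
    Continuous f ∧
    (∀ x : ℝ, x ∉ ({0, Real.sqrt (2*t*h), -Real.sqrt (2*t*h)} : Set ℝ) →
      DifferentiableAt ℝ f x) ∧
    Integrable (fun x : ℝ => (1/2) * (deriv f x)^2 - (1/2) * (x/t)^2) ∧
    ∫ x : ℝ, ((1/2) * (deriv f x)^2 - (1/2) * (x/t)^2) =
      (4/3) * (2/t) ^ ((1:ℝ)/2) * h ^ ((3:ℝ)/2) := by
  obtain ⟨a, ha⟩ : ∃ a, a = Real.sqrt (2*t*h) := ⟨_, rfl⟩
  have ha0 : 0 ≤ a := ha ▸ Real.sqrt_nonneg _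
  have hsq : a^2 = 2*t*h := by rw [ha]; exact Real.sq_sqrt (by positivity)
  have hs : Real.sqrt (2*h/t) = a/t := by
    rw [Real.sqrt_eq_iff_eq_sq (by positivity) (by positivity), div_pow, hsq]
    field_simp
  rw [hs] at hf
  rw [← ha] at hf ⊢
  have hout : ∀ x, a < |x| → HasDerivAt f (-(x/t)) x := by
    intro x hx
    have h1 : HasDerivAt (fun y : ℝ => -y^2/(2*t)) (-(x/t)) x := by
      have h2 := (((hasDerivAt_id x).pow 2).neg).div_const (2*t)
      refine (h2.congr_deriv ?_)
      simp only [id]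
      field_simp
      norm_num
    refine h1.congr_of_eventuallyEq ?_
    filter_upwards [(isOpen_lt continuous_const continuous_abs).mem_nhds hx] with y hy
    rw [hf, if_neg (not_le.mpr hy)]
  have hin : ∀ x, x ≠ 0 → |x| < a → ∃ d, d^2 = (a/t)^2 ∧ HasDerivAt f d x := by
    intro x hx0 hx
    have key : ∀ e, HasDerivAt (fun y : ℝ => |y|) e x → HasDerivAt f (-(a/t*e)) x := by
      intro e he
      refine ((he.const_mul (a/t)).const_sub h).congr_of_eventuallyEq ?_
      filter_upwards [(isOpen_lt continuous_abs continuous_const).mem_nhds hx] with y hy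
      rw [hf, if_pos (le_of_lt hy)]
    rcases lt_or_gt_of_ne hx0 with h0 | h0
    · exact ⟨_, by ring, key _ (hasDerivAt_abs_neg h0)⟩
    · exact ⟨_, by ring, key _ (hasDerivAt_abs_pos h0)⟩
  have hab : ∀ x : ℝ, x ∉ ({0, a, -a} : Set ℝ) → x ≠ 0 ∧ |x| ≠ a := by
    intro x hx
    simp only [Set.mem_insert_iff, Set.mem_singleton_iff, not_or] at hx
    refine ⟨hx.1, fun h' => ?_⟩
    rcases abs_choice x with h1 | h1
    · exact hx.2.1 (h1 ▸ h')
    · exact hx.2.2 (by linarith)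
  have hae : (fun x : ℝ => (1/2) * (deriv f x)^2 - (1/2) * (x/t)^2) =ᵐ[volume]
      (Set.Icc (-a) a).indicator (fun x : ℝ => (1/2) * (a/t)^2 - (1/2) * (x/t)^2) := by
    have hnull : (volume : Measure ℝ) ({0, a, -a} : Set ℝ) = 0 :=
      (Set.toFinite _).measure_zero _
    filter_upwards [compl_mem_ae_iff.mpr hnull] with x hx
    obtain ⟨h0, h1⟩ := hab x hx
    rcases lt_or_gt_of_ne h1 with h2 | h2
    · obtain ⟨d, hd, hd'⟩ := hin x h0 h2
      rw [Set.indicator_of_mem (Set.mem_Icc.mpr (abs_le.mp h2.le)), hd'.deriv, hd]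
    · rw [Set.indicator_of_notMem (fun hm : x ∈ Set.Icc (-a) a => absurd (abs_le.mpr (Set.mem_Icc.mp hm)) (not_le.mpr h2)),
        (hout x h2).deriv]
      ring
  have hcont : Continuous (fun x : ℝ => (1/2) * (a/t)^2 - (1/2) * (x/t)^2) := by fun_prop
  refine ⟨?_, ?_, ?_, ?_⟩
  · rw [funext hf]
    refine Continuous.if_le (by fun_prop) (by fun_prop) continuous_abs continuous_const ?_
    intro x hx
    rw [← sq_abs x, hx, hsq]
    field_simp
    rw [hsq]
    ring
  · intro x hx
    obtain ⟨h0, h1⟩ := hab x hx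
    rcases lt_or_gt_of_ne h1 with h2 | h2
    · obtain ⟨d, _, hd'⟩ := hin x h0 h2
      exact hd'.differentiableAt
    · exact (hout x h2).differentiableAt
  · refine Integrable.congr ?_ hae.symm
    exact (hcont.continuousOn.integrableOn_Icc).integrable_indicator measurableSet_Icc
  · rw [integral_congr_ae hae, integral_indicator measurableSet_Icc,
      integral_Icc_eq_integral_Ioc, ← intervalIntegral.integral_of_le (by linarith)]
    have hI : ∫ x in (-a)..a, ((1/2) * (a/t)^2 - (1/2) * (x/t)^2) = 2/3 * a^3/t^2 := by
      rw [intervalIntegral.integral_eq_sub_of_hasDerivAt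
        (f := fun x => (1/2) * (a/t)^2 * x - x^3/(6*t^2)) _ (hcont.intervalIntegrable _ _)]
      · field_simp
        ring
      · intro x _
        refine (((hasDerivAt_id x).const_mul ((1/2) * (a/t)^2)).sub
          (((hasDerivAt_id x).pow 3).div_const (6*t^2))).congr_deriv ?_
        simp only [id]
        field_simp
        norm_num
        try ring
    have hh32 : h ^ ((3:ℝ)/2) = h * Real.sqrt h := by
      rw [show (3:ℝ)/2 = 1 + 1/2 by norm_num, Real.rpow_add_of_nonneg hh (by norm_num) (by norm_num),
        Real.rpow_one, Real.sqrt_eq_rpow]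
    have hm : Real.sqrt (2/t) * Real.sqrt h = a/t := by
      rw [← Real.sqrt_mul (by positivity), ← hs]
      congr 1
      ring
    rw [hI, hh32, ← Real.sqrt_eq_rpow]
    calc 2/3 * a^3/t^2 = 2/3 * (a^2) * (a/t)/t := by field_simp
      _ = 4/3 * h * (a/t) := by rw [hsq]; field_simp; ring
      _ = _ := by rw [← hm]; ring
end

section
/- Fix h > 0 and let g be the one-point KPZ limit shape. Then g is continuous on (0,∞) × ℝ, g(1,0) = h, and at every point (t,x) with t > 0 and x ≠ 0, g is differentiable and satisfies ∂ₜg(t,x) = ½·(∂ₓg(t,x))². -/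
/-- The one-point KPZ limit shape for deviation size `h`:
`g(t,x) = t·h − √(2h)·|x|` if `|x| ≤ t·√(2h)`, and `g(t,x) = −x²/(2t)` otherwise. -/
noncomputable def limitShape (h : ℝ) (p : ℝ × ℝ) : ℝ :=
  if |p.2| ≤ p.1 * Real.sqrt (2*h) then p.1 * h - Real.sqrt (2*h) * |p.2|
  else -p.2^2/(2*p.1)

lemma limitShape_aux_deriv (u : ℝ) :
    HasDerivAt (fun u : ℝ => (max 0 u)^2) (2 * max 0 u) u := by
  rcases lt_trichotomy u 0 with hu | hu | hu
  · rw [max_eq_left hu.le, mul_zero]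
    refine (hasDerivAt_const u (0:ℝ)).congr_of_eventuallyEq ?_
    filter_upwards [Iio_mem_nhds hu] with v hv
    have hv' : v < 0 := hv
    simp [max_eq_left hv'.le]
  · subst hu
    rw [hasDerivAt_iff_tendsto_slope]
    have hc : Filter.Tendsto (fun v : ℝ => max 0 v) (nhdsWithin 0 {0}ᶜ) (nhds (2 * max 0 0)) := by
      have : Continuous (fun v : ℝ => max 0 v) := by fun_prop
      have h2 := this.tendsto 0
      simp only [max_self, mul_zero] at h2 ⊢
      exact h2.mono_left nhdsWithin_le_nhds
    refine hc.congr' ?_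
    filter_upwards [self_mem_nhdsWithin] with v hv
    have hv' : v ≠ 0 := hv
    rw [slope_def_field]
    rcases le_total v 0 with h | h
    · simp [max_eq_left h]
    · simp only [max_eq_right h, max_self]
      field_simp
      ring
  · rw [max_eq_right hu.le]
    have h1 := hasDerivAt_pow 2 u
    have h2 : HasDerivAt (fun v : ℝ => v^2) (2 * u) u := by simpa using h1
    refine h2.congr_of_eventuallyEq ?_
    filter_upwards [Ioi_mem_nhds hu] with v hv
    have hv' : 0 < v := hv
    simp [max_eq_right hv'.le]

lemma limitShape_closed (h : ℝ) (hh : 0 < h) (p : ℝ × ℝ) (hp : 0 < p.1) :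
    limitShape h p =
      ((max 0 (Real.sqrt (2*h) * p.1 - |p.2|))^2 - p.2^2) * (2 * p.1)⁻¹ := by
  have hs : Real.sqrt (2*h) ^ 2 = 2*h := Real.sq_sqrt (by positivity)
  unfold limitShape
  generalize Real.sqrt (2*h) = s at hs ⊢
  split_ifs with hc
  · rw [max_eq_right (by linarith), ← sq_abs p.2]
    field_simp
    linear_combination (-p.1^2) * hs
  · rw [max_eq_left (by linarith)]
    field_simp
    ring

/-- The one-point KPZ limit shape is continuous on `(0,∞) × ℝ`, equals `h`
at `(1,0)`, and solves the integrated Burgers equation `∂ₜg = ½(∂ₓg)²` classically at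
every point `(t,x)` with `t > 0`, `x ≠ 0`. -/
theorem stmt_3 (h : ℝ) (hh : 0 < h) :
    ContinuousOn (limitShape h) (Set.Ioi 0 ×ˢ Set.univ) ∧
    limitShape h (1, 0) = h ∧
    ∀ t x : ℝ, 0 < t → x ≠ 0 →
      DifferentiableAt ℝ (limitShape h) (t, x) ∧
      fderiv ℝ (limitShape h) (t, x) (1, 0) =
        (1/2) * (fderiv ℝ (limitShape h) (t, x) (0, 1))^2 := by
  have hs : Real.sqrt (2*h) ^ 2 = 2*h := Real.sq_sqrt (by positivity)
  refine ⟨?_, ?_, ?_⟩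
  · have hc : ContinuousOn (fun p : ℝ × ℝ =>
        ((max 0 (Real.sqrt (2*h) * p.1 - |p.2|))^2 - p.2^2) * (2 * p.1)⁻¹)
        (Set.Ioi 0 ×ˢ Set.univ) := by
      refine ContinuousOn.mul (by fun_prop) (ContinuousOn.inv₀ (by fun_prop) ?_)
      rintro p ⟨hp, -⟩
      have hp' : 0 < p.1 := hp
      positivity
    exact hc.congr fun p hp => limitShape_closed h hh p hp.1
  · simp [limitShape]
  · intro t x ht hx
    obtain ⟨e, he, hex, hee⟩ : ∃ e : ℝ, HasDerivAt (fun y : ℝ => |y|) e x ∧ e * x = |x| ∧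
        e^2 = 1 := by
      rcases lt_or_gt_of_ne hx with h0 | h0
      · exact ⟨-1, hasDerivAt_abs_neg h0, by rw [abs_of_neg h0]; ring, by norm_num⟩
      · exact ⟨1, hasDerivAt_abs_pos h0, by rw [abs_of_pos h0]; ring, by norm_num⟩
    have hf : HasFDerivAt (fun p : ℝ × ℝ => p.1) (ContinuousLinearMap.fst ℝ ℝ ℝ) (t, x) :=
      hasFDerivAt_fst
    have hsn : HasFDerivAt (fun p : ℝ × ℝ => p.2) (ContinuousLinearMap.snd ℝ ℝ ℝ) (t, x) :=
      hasFDerivAt_snd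
    have habs := HasDerivAt.comp_hasFDerivAt (t, x) (h₂ := fun y : ℝ => |y|) he hsn
    have hin := (hf.const_mul (Real.sqrt (2*h))).sub habs
    have hm := HasDerivAt.comp_hasFDerivAt (t, x)
      (limitShape_aux_deriv (Real.sqrt (2*h) * t - |x|)) hin
    have hinv := HasDerivAt.comp_hasFDerivAt (t, x) (hasDerivAt_inv (x := 2 * t) (by positivity))
      (hf.const_mul 2)
    have hG := (hm.sub (hsn.pow 2)).mul hinv
    have hL := hG.congr_of_eventuallyEq (f₁ := limitShape h) (by
      have : ∀ᶠ p : ℝ × ℝ in nhds (t, x), 0 < p.1 :=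
        (continuous_fst.tendsto (t, x)).eventually (Ioi_mem_nhds ht)
      filter_upwards [this] with p hp
      rw [limitShape_closed h hh p hp]
      rfl)
    refine ⟨hL.differentiableAt, ?_⟩
    rw [hL.fderiv]
    have hu : max 0 (Real.sqrt (2*h) * t - |x|) * (Real.sqrt (2*h) * t - |x|)
        = max 0 (Real.sqrt (2*h) * t - |x|)^2 := by
      rcases le_total (Real.sqrt (2*h) * t - |x|) 0 with h0 | h0
      · rw [max_eq_left h0]; ring
      · rw [max_eq_right h0]; ring
    clear hL hG hm hin hs
    generalize Real.sqrt (2*h) = s at hu ⊢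
    simp
    generalize max 0 (s * t - |x|) = u at *
    rw [← hex] at hu
    field_simp
    linear_combination 2 * hu - u^2 * hee
end

section
/- Fix h > 0 and define u : (0,∞) × ℝ → ℝ by u(t,x) = −√(2h)·sgn(x) if |x| < t·√(2h), and u(t,x) = −x/t otherwise, where sgn(y) = 1, −1, 0 according as y > 0, y < 0, y = 0. Then for every C^∞ function φ : ℝ × ℝ → ℝ with compact support contained in (0,1) × ℝ, ∫₀¹ ∫_ℝ ( u(t,x)·∂ₜφ(t,x) − ½·u(t,x)²·∂ₓφ(t,x) ) dx dt = 0; that is, u is a weak solution of the Burgers equation ∂ₜu = ∂ₓ(u²/2) on (0,1) × ℝ. -/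
/-- The spatial derivative of the one-point KPZ limit shape:
`u(t,x) = −√(2h)·sgn(x)` if `|x| < t·√(2h)`, and `u(t,x) = −x/t` otherwise. -/
noncomputable def uShape (h : ℝ) (p : ℝ × ℝ) : ℝ :=
  if |p.2| < p.1 * Real.sqrt (2*h) then -Real.sqrt (2*h) * Real.sign p.2
  else -p.2/p.1

open MeasureTheory Set Filter Topology

lemma hasDerivAt_maxsq (y : ℝ) : HasDerivAt (fun y : ℝ => (max y 0)^2) (2 * max y 0) y := by
  rcases lt_trichotomy y 0 with hy | hy | hy
  · have : (fun y : ℝ => (max y 0)^2) =ᶠ[𝓝 y] fun _ => 0 := by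
      filter_upwards [Iio_mem_nhds hy] with z hz
      simp [max_eq_right (le_of_lt (show z < 0 from hz))]
    rw [max_eq_right hy.le, mul_zero]
    exact (hasDerivAt_const y (0:ℝ)).congr_of_eventuallyEq this
  · subst hy
    have h1 : (fun y : ℝ => (max y 0)^2) =O[𝓝 0] fun y => ‖y - 0‖^2 := by
      refine Asymptotics.IsBigO.of_bound 1 (Eventually.of_forall fun z => ?_)
      simp only [sub_zero, norm_pow, norm_norm, one_mul, Real.norm_eq_abs]
      gcongr
      rcases le_total z 0 with h | h
      · simp [max_eq_right h]
      · simp [max_eq_left h, le_abs_self]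
    have h2 := (h1.hasFDerivAt (𝕜 := ℝ) (by norm_num)).hasDerivAt
    simpa using h2
  · have : (fun y : ℝ => (max y 0)^2) =ᶠ[𝓝 y] fun y => y^2 := by
      filter_upwards [Ioi_mem_nhds hy] with z hz
      simp [max_eq_left (le_of_lt (show 0 < z from hz))]
    rw [max_eq_left hy.le]
    have h2 := (hasDerivAt_pow 2 y).congr_of_eventuallyEq this
    simpa using h2

/-- The limit shape. -/
noncomputable def gS (s : ℝ) (p : ℝ × ℝ) : ℝ :=
  -p.2^2/(2*p.1) + (max (p.1*s - |p.2|) 0)^2/(2*p.1)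

lemma gS_x (h : ℝ) (t x : ℝ) (ht : 0 < t) (hx : x ≠ 0) :
    HasDerivAt (fun x => gS (Real.sqrt (2*h)) (t, x)) (uShape h (t, x)) x := by
  set s := Real.sqrt (2*h) with hs
  have h1 : HasDerivAt (fun x : ℝ => t*s - |x|) (-(SignType.sign x : ℝ)) x := by
    simpa using (hasDerivAt_abs hx).const_sub (t*s)
  have h2 := (hasDerivAt_maxsq (t*s - |x|)).comp x h1
  have h3 := ((((hasDerivAt_pow 2 x).neg).div_const (2*t)).add (h2.div_const (2*t)))
  refine h3.congr_deriv ?_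
  simp only [uShape, ← hs]
  split_ifs with hc
  · rw [max_eq_left (by linarith)]
    rcases lt_or_gt_of_ne hx with h | h
    · simp [Real.sign_of_neg h, abs_of_neg h, sign_neg h]; field_simp; ring
    · simp [Real.sign_of_pos h, abs_of_pos h, sign_pos h]; field_simp; ring
  · rw [max_eq_right (by linarith)]
    simp; field_simp

lemma gS_t (h : ℝ) (hh : 0 < h) (t x : ℝ) (ht : 0 < t) (hx : x ≠ 0) :
    HasDerivAt (fun t => gS (Real.sqrt (2*h)) (t, x)) (1/2 * (uShape h (t, x))^2) t := by
  set s := Real.sqrt (2*h) with hs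
  have h1 : HasDerivAt (fun t : ℝ => t*s - |x|) s t := by
    simpa using ((hasDerivAt_id t).mul_const s).sub_const (|x|)
  have h2 := (hasDerivAt_maxsq (t*s - |x|)).comp t h1
  have h0 : HasDerivAt (fun t : ℝ => 2*t) 2 t := by
    simpa using (hasDerivAt_id t).const_mul 2
  have h3 := ((hasDerivAt_const t (-x^2)).div h0 (by positivity)).add
    (h2.div h0 (by positivity))
  refine h3.congr_deriv ?_
  simp only [uShape, ← hs]
  split_ifs with hc
  · simp only [Function.comp]
    rw [max_eq_left (by linarith)]
    have hsg : (Real.sign x)^2 = 1 := by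
      rcases lt_or_gt_of_ne hx with h | h
      · simp [Real.sign_of_neg h]
      · simp [Real.sign_of_pos h]
    have : (-s * Real.sign x)^2 = s^2 := by rw [mul_pow, hsg]; ring
    rw [this]
    have := sq_abs x
    rw [← this]
    field_simp; ring
  · simp only [Function.comp]
    rw [max_eq_right (by linarith)]
    field_simp; ring

lemma uShape_meas (h : ℝ) : Measurable (uShape h) := by
  have hs : Measurable Real.sign := by
    have : Real.sign = fun r : ℝ => if r < 0 then (-1:ℝ) else if 0 < r then 1 else 0 := rfl
    rw [this]
    exact Measurable.ite measurableSet_Iio measurable_const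
      (Measurable.ite measurableSet_Ioi measurable_const measurable_const)
  unfold uShape
  refine Measurable.ite ?_ ?_ ?_
  · exact measurableSet_lt (by fun_prop) (by fun_prop)
  · exact measurable_const.mul (hs.comp measurable_snd)
  · fun_prop

lemma uShape_bd (h : ℝ) (p : ℝ × ℝ) : |uShape h p| ≤ Real.sqrt (2*h) + |p.2/p.1| := by
  have h0 := Real.sqrt_nonneg (2*h)
  unfold uShape
  split_ifs
  · have : |Real.sign p.2| ≤ 1 := by
      rcases Real.sign_apply_eq p.2 with h | h | h <;> simp [h]
    rw [abs_mul, abs_neg, abs_of_nonneg h0]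
    nlinarith [abs_nonneg (p.2/p.1)]
  · rw [neg_div, abs_neg]; linarith

lemma gS_meas (s : ℝ) : Measurable (gS s) := by
  unfold gS; fun_prop

lemma int_aux (K : Set (ℝ × ℝ)) (hK : IsCompact K) (w b D : ℝ × ℝ → ℝ) (hw : Measurable w)
    (hb : ContinuousOn b K) (hwb : ∀ p, |w p| ≤ b p) (hD : Continuous D)
    (hDK : ∀ p, p ∉ K → D p = 0) : Integrable (fun p => w p * D p) (volume.prod volume) := by
  have h1 : IntegrableOn (fun p => b p * D p) K (volume.prod volume) :=
    (hb.mul hD.continuousOn).integrableOn_compact hK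
  have h2 : Integrable (fun p => b p * D p) (volume.prod volume) := by
    refine (integrableOn_iff_integrable_of_support_subset ?_).1 h1
    intro p hp
    by_contra hc
    exact hp (by simp [hDK p hc])
  refine h2.mono (hw.mul hD.measurable).aestronglyMeasurable (Eventually.of_forall fun p => ?_)
  simp only [norm_mul, Real.norm_eq_abs]
  exact mul_le_mul_of_nonneg_right ((hwb p).trans (le_abs_self _)) (abs_nonneg _)

/-- `u` is a weak solution of the Burgers equation `∂ₜu = ∂ₓ(u²/2)` on
`(0,1) × ℝ`: for every smooth `φ` compactly supported in `(0,1) × ℝ`,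
`∫₀¹∫_ℝ (u·∂ₜφ − ½u²·∂ₓφ) dx dt = 0`. -/
theorem stmt_4 (h : ℝ) (hh : 0 < h)
    (φ : ℝ × ℝ → ℝ) (hφ : ContDiff ℝ (⊤ : ℕ∞) φ) (hsupp : HasCompactSupport φ)
    (hsupp' : tsupport φ ⊆ Set.Ioo (0:ℝ) 1 ×ˢ Set.univ) :
    ∫ t in Set.Ioo (0:ℝ) 1, ∫ x : ℝ,
      (uShape h (t, x) * fderiv ℝ φ (t, x) (1, 0)
        - (1/2) * (uShape h (t, x))^2 * fderiv ℝ φ (t, x) (0, 1)) = 0 := by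
  set K := tsupport φ with hKdef
  have hK : IsCompact K := hsupp
  have hd1 : ContDiff ℝ 1 (fderiv ℝ φ) := hφ.fderiv_right (by norm_cast)
  have hD1 : Differentiable ℝ (fderiv ℝ φ) := hd1.differentiable (by norm_num)
  have hc2 : Continuous (fderiv ℝ (fderiv ℝ φ)) := hd1.continuous_fderiv (by norm_num)
  have hz1 : ∀ p, p ∉ K → fderiv ℝ φ p = 0 := fun p hp =>
    image_eq_zero_of_notMem_tsupport (fun hq => hp (tsupport_fderiv_subset ℝ hq))
  have hz2 : ∀ p, p ∉ K → fderiv ℝ (fderiv ℝ φ) p = 0 := fun p hp =>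
    image_eq_zero_of_notMem_tsupport
      (fun hq => hp (tsupport_fderiv_subset ℝ (tsupport_fderiv_subset ℝ hq)))
  have hsym : ∀ p v w, fderiv ℝ (fderiv ℝ φ) p v w = fderiv ℝ (fderiv ℝ φ) p w v := by
    intro p v w
    exact (hφ.contDiffAt.isSymmSndFDerivAt (by simp only [minSmoothness_of_isRCLikeNormedField]; exact WithTop.coe_le_coe.2 (le_top (a := (2 : ℕ∞))))) v w
  set A : ℝ × ℝ → ℝ := fun p => fderiv ℝ φ p (1, 0) with hA
  set B : ℝ × ℝ → ℝ := fun p => fderiv ℝ φ p (0, 1) with hB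
  set C : ℝ × ℝ → ℝ := fun p => fderiv ℝ (fderiv ℝ φ) p (0, 1) (1, 0) with hC
  have hAc : Continuous A := by have := hd1.continuous; fun_prop
  have hBc : Continuous B := by have := hd1.continuous; fun_prop
  have hCc : Continuous C := by fun_prop
  have hAz : ∀ p, p ∉ K → A p = 0 := fun p hp => by simp [hA, hz1 p hp]
  have hBz : ∀ p, p ∉ K → B p = 0 := fun p hp => by simp [hB, hz1 p hp]
  have hCz : ∀ p, p ∉ K → C p = 0 := fun p hp => by simp [hC, hz2 p hp]
  have hAx : ∀ t x, HasDerivAt (fun x => A (t, x)) (C (t, x)) x := by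
    intro t x
    have h1 : HasDerivAt (fun x : ℝ => (t, x)) ((0:ℝ), (1:ℝ)) x :=
      (hasDerivAt_const x t).prodMk (hasDerivAt_id x)
    have h2 := (hD1 (t, x)).hasFDerivAt.comp_hasDerivAt x h1
    simpa using h2.clm_apply (hasDerivAt_const x ((1:ℝ), (0:ℝ)))
  have hBt : ∀ t x, HasDerivAt (fun t => B (t, x)) (C (t, x)) t := by
    intro t x
    have h1 : HasDerivAt (fun t : ℝ => (t, x)) ((1:ℝ), (0:ℝ)) t :=
      (hasDerivAt_id t).prodMk (hasDerivAt_const t x)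
    have h2 := (hD1 (t, x)).hasFDerivAt.comp_hasDerivAt t h1
    have h3 := h2.clm_apply (hasDerivAt_const t ((0:ℝ), (1:ℝ)))
    simp only [hC]
    rw [hsym]
    simpa using h3
  set s := Real.sqrt (2*h) with hs
  have hKpos : ∀ p ∈ K, 0 < p.1 := fun p hp => (hsupp' hp).1.1
  have hq : ContinuousOn (fun p : ℝ × ℝ => p.2/p.1) K :=
    continuousOn_snd.div continuousOn_fst (fun p hp => (hKpos p hp).ne')
  have hgc : ContinuousOn (gS s) K := by
    unfold gS
    have hne : ∀ p ∈ K, 2 * p.1 ≠ 0 := fun p hp => by have := hKpos p hp; positivity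
    exact (ContinuousOn.div (by fun_prop) (by fun_prop) hne).add
      (ContinuousOn.div (by fun_prop) (by fun_prop) hne)
  have iA : Integrable (fun p => uShape h p * A p) (volume.prod volume) :=
    int_aux K hK _ (fun p => s + |p.2/p.1|) A (uShape_meas h) (continuousOn_const.add hq.abs)
      (uShape_bd h) hAc hAz
  have iB : Integrable (fun p => (1/2 * uShape h p ^ 2) * B p) (volume.prod volume) := by
    refine int_aux K hK _ (fun p => 1/2 * (s + |p.2/p.1|)^2) B
      (((uShape_meas h).pow_const 2).const_mul _)
      (((continuousOn_const.add hq.abs).pow 2).const_mul _) ?_ hBc hBz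
    intro p
    rw [abs_mul, abs_pow, abs_of_pos (by norm_num : (0:ℝ) < 1/2)]
    have := uShape_bd h p
    gcongr
  have iC : Integrable (fun p => gS s p * C p) (volume.prod volume) :=
    int_aux K hK _ (fun p => |gS s p|) C (gS_meas s) hgc.abs (fun p => le_rfl) hCc hCz
  -- reduce to the full line
  rw [setIntegral_eq_integral_of_forall_compl_eq_zero]
  swap
  · intro t ht
    have : ∀ x : ℝ, (t, x) ∉ K := fun x hx => ht (hsupp' hx).1
    simp [hz1 _ (this _)]
  have iF : Integrable (fun p => uShape h p * A p + gS s p * C p) (volume.prod volume) :=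
    iA.add iC
  have iG : Integrable (fun p => (1/2 * uShape h p ^ 2) * B p + gS s p * C p)
    (volume.prod volume) := iB.add iC
  have hF0 : ∀ᵐ t : ℝ, ∫ x : ℝ, (uShape h (t, x) * A (t, x) + gS s (t, x) * C (t, x)) = 0 := by
    filter_upwards [iF.prod_right_ae] with t hit
    by_cases ht : 0 < t
    · have hder : ∀ x ≠ 0, HasDerivAt (fun x => gS s (t, x) * A (t, x))
          (uShape h (t, x) * A (t, x) + gS s (t, x) * C (t, x)) x := fun x hx =>
        (gS_x h t x ht hx).mul (hAx t x)
      have hcont : Continuous (fun x => gS s (t, x) * A (t, x)) := by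
        have hA' : Continuous (fun x => A (t, x)) := hAc.comp (by fun_prop)
        refine Continuous.mul ?_ hA'
        simp only [gS, div_eq_mul_inv]
        fun_prop
      have hcs : HasCompactSupport (fun x => gS s (t, x) * A (t, x)) := by
        refine HasCompactSupport.intro (hK.image continuous_snd) (fun x hx => ?_)
        rw [hAz, mul_zero]
        exact fun hp => hx ⟨(t, x), hp, rfl⟩
      have hlim := hcs.is_zero_at_infty
      rw [cocompact_eq_atBot_atTop, tendsto_sup] at hlim
      have e1 := integral_Ioi_of_hasDerivAt_of_tendsto (a := 0) hcont.continuousWithinAt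
        (fun x hx => hder x (ne_of_gt hx)) hit.integrableOn hlim.2
      have e2 := integral_Iic_of_hasDerivAt_of_tendsto (a := 0) hcont.continuousWithinAt
        (fun x hx => hder x (ne_of_lt hx)) hit.integrableOn hlim.1
      rw [← intervalIntegral.integral_Iic_add_Ioi (b := 0) hit.integrableOn hit.integrableOn,
        e1, e2]
      ring
    · have : ∀ x : ℝ, (t, x) ∉ K := fun x hx => ht (hKpos _ hx)
      simp [hAz _ (this _), hCz _ (this _)]
  have hG0 : ∀ᵐ x : ℝ, ∫ t : ℝ, ((1/2 * uShape h (t, x) ^ 2) * B (t, x)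
      + gS s (t, x) * C (t, x)) = 0 := by
    have hne : ∀ᵐ x : ℝ, x ≠ 0 := by simp [ae_iff]
    filter_upwards [iG.prod_left_ae, hne] with x hix hx
    have hder : ∀ t, HasDerivAt (fun t => gS s (t, x) * B (t, x))
          ((1/2 * uShape h (t, x) ^ 2) * B (t, x) + gS s (t, x) * C (t, x)) t := by
      intro t
      by_cases ht : (t, x) ∈ K
      · exact (gS_t h hh t x (hKpos _ ht) hx).mul (hBt t x)
      · have hev : (fun t => gS s (t, x) * B (t, x)) =ᶠ[𝓝 t] fun _ => 0 := by
          have hop : Kᶜ ∈ 𝓝 (t, x) := (isClosed_tsupport φ).isOpen_compl.mem_nhds ht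
          have hct : Continuous (fun t : ℝ => (t, x)) := by fun_prop
          filter_upwards [hct.continuousAt.preimage_mem_nhds hop] with r hr
          rw [hBz _ hr, mul_zero]
        rw [hBz _ ht, hCz _ ht]
        simpa using (hasDerivAt_const t (0:ℝ)).congr_of_eventuallyEq hev
    have hcs : HasCompactSupport (fun t => gS s (t, x) * B (t, x)) := by
      refine HasCompactSupport.intro (hK.image continuous_fst) (fun t ht => ?_)
      rw [hBz, mul_zero]
      exact fun hp => ht ⟨(t, x), hp, rfl⟩
    have hcont : Continuous (fun t => gS s (t, x) * B (t, x)) :=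
      continuous_iff_continuousAt.2 fun t => (hder t).continuousAt
    exact integral_eq_zero_of_hasDerivAt_of_integrable hder hix
      (hcont.integrable_of_hasCompactSupport hcs)
  have key : ∫ p, ((uShape h p * A p + gS s p * C p)
      - ((1/2 * uShape h p ^ 2) * B p + gS s p * C p)) ∂((volume : Measure ℝ).prod volume) = 0 := by
    have e1 := integral_prod _ iF
    have e2 := integral_prod_symm _ iG
    rw [integral_sub iF iG]
    rw [e1, e2, integral_congr_ae hF0, integral_congr_ae hG0]
    simp
  have i3 : Integrable (fun p => (uShape h p * A p + gS s p * C p)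
      - ((1/2 * uShape h p ^ 2) * B p + gS s p * C p)) (volume.prod volume) := iF.sub iG
  rw [integral_prod _ i3] at key
  refine Eq.trans ?_ key
  refine integral_congr_ae (Eventually.of_forall fun t => ?_)
  refine integral_congr_ae (Eventually.of_forall fun x => ?_)
  simp only [hA, hB]
  ring
end

section
/- Let (Ω, F, P) be a probability space, A ∈ F, and Z₁, …, Z_m : Ω → [0,∞) measurable functions. Suppose that for every r = (r₁, …, r_m) with all r_j > 0 one has P(A ∩ ⋂_{j=1}^m {Z_j ≥ r_j}) ≥ P(A) · P(⋂_{j=1}^m {Z_j ≥ r_j}). Then ∫_A ∏_{j=1}^m Z_j dP ≥ P(A) · ∫_Ω ∏_{j=1}^m Z_j dP, where the integrals are taken in [0, ∞]. -/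
open MeasureTheory

/-- Layer-cake representation of the integral of a product, via Tonelli. -/
theorem layer_cake_prod {Ω : Type*} [MeasurableSpace Ω] (ν : Measure Ω) [IsFiniteMeasure ν]
    (m : ℕ) (Z : Fin m → Ω → ℝ) (hZ : ∀ j, Measurable (Z j)) :
    ∫⁻ ω, (∏ j, ENNReal.ofReal (Z j ω)) ∂ν =
      ∫⁻ r : Fin m → ℝ, ν {ω | ∀ j, 0 < r j ∧ r j ≤ Z j ω} := by
  have hS : MeasurableSet {p : Ω × (Fin m → ℝ) | ∀ j, 0 < p.2 j ∧ p.2 j ≤ Z j p.1} := by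
    rw [Set.setOf_forall]
    refine MeasurableSet.iInter fun j => ?_
    have h1 : Measurable fun p : Ω × (Fin m → ℝ) => p.2 j :=
      (measurable_pi_apply j).comp measurable_snd
    exact (measurableSet_lt measurable_const h1).inter
      (measurableSet_le h1 ((hZ j).comp measurable_fst))
  have e1 := Measure.prod_apply (μ := ν) (ν := (volume : Measure (Fin m → ℝ))) hS
  have e2 := Measure.prod_apply_symm (μ := ν) (ν := (volume : Measure (Fin m → ℝ))) hS
  rw [e1] at e2
  refine Eq.trans (lintegral_congr fun ω => ?_) e2
  have : (Prod.mk ω ⁻¹' {p : Ω × (Fin m → ℝ) | ∀ j, 0 < p.2 j ∧ p.2 j ≤ Z j p.1}) =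
      Set.univ.pi fun j => Set.Ioc 0 (Z j ω) := by
    ext r
    simp
  rw [this, volume_pi_pi]
  simp

/-- FKG-type upgrade: if an event `A` is positively correlated with every
joint upper level set of nonnegative random variables `Z₁, …, Z_m`, then
`∫_A ∏ Z_j dP ≥ P(A) · ∫ ∏ Z_j dP` (integrals in `[0,∞]`). -/
theorem stmt_7 {Ω : Type*} [MeasurableSpace Ω] (P : Measure Ω) [IsProbabilityMeasure P]
    (A : Set Ω) (hA : MeasurableSet A) (m : ℕ) (Z : Fin m → Ω → ℝ)
    (hZmeas : ∀ j, Measurable (Z j)) (hZnonneg : ∀ j ω, 0 ≤ Z j ω)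
    (hcorr : ∀ r : Fin m → ℝ, (∀ j, 0 < r j) →
      P A * P (⋂ j, {ω | r j ≤ Z j ω}) ≤ P (A ∩ ⋂ j, {ω | r j ≤ Z j ω})) :
    P A * ∫⁻ ω, (∏ j, ENNReal.ofReal (Z j ω)) ∂P ≤
      ∫⁻ ω in A, (∏ j, ENNReal.ofReal (Z j ω)) ∂P := by
  rw [layer_cake_prod P m Z hZmeas, layer_cake_prod (P.restrict A) m Z hZmeas,
    ← lintegral_const_mul' _ _ (measure_ne_top P A)]
  refine lintegral_mono fun r => ?_
  by_cases hr : ∀ j, 0 < r j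
  · have hset : {ω | ∀ j, 0 < r j ∧ r j ≤ Z j ω} = ⋂ j, {ω | r j ≤ Z j ω} := by
      ext ω
      simp [hr]
    simp only [hset]
    rw [Measure.restrict_apply' hA, Set.inter_comm]
    exact hcorr r hr
  · have hset : {ω | ∀ j, 0 < r j ∧ r j ≤ Z j ω} = ∅ := by
      ext ω
      simp only [Set.mem_setOf_eq, Set.mem_empty_iff_false, iff_false]
      exact fun h => hr fun j => (h j).1
    simp [hset]
end

section
/- Let m₋, m₊ ≥ 0 and m := m₋ + m₊. Let g₁, g₂ : [0,1] → ℝ be measurable with g₁² and g₂² integrable on [0,1], with ∫₀¹ g₁(s) ds = 1 and ∫₀¹ g₂(s) ds = −1, and define γ₁(s) := −1 + ∫₀^s g₁ and γ₂(s) := 1 + ∫₀^s g₂ (so γ₁(0) = −1, γ₂(0) = 1, γ₁(1) = γ₂(1) = 0). Let s_m ∈ [0,1] be such that γ₁(s) = γ₂(s) for all s ∈ [s_m, 1]. Then (1/24)·( (1 − s_m)·(m₋³ + m₊³) + s_m·m³ ) − (m₋/2)·∫₀¹ g₁(s)² ds − (m₊/2)·∫₀¹ g₂(s)² ds ≤ m³/24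 − m/2. Moreover, if m₋ > 0, m₊ > 0 and s_m < 1, the inequality is strict. -/
open MeasureTheory intervalIntegral

theorem energy_ge (g : ℝ → ℝ) (c : ℝ) (hc : c ^ 2 = 1)
    (hsq : IntegrableOn (fun s => (g s)^2) (Set.Icc 0 1))
    (hint : (∫ s in (0:ℝ)..1, g s) = c) : 1 ≤ ∫ s in (0:ℝ)..1, (g s)^2 := by
  have h1 : IntervalIntegrable g volume 0 1 := by
    by_contra h
    rw [intervalIntegral.integral_undef h] at hint
    rw [← hint] at hc
    norm_num at hc
  have h2 : IntervalIntegrable (fun s => (g s)^2) volume 0 1 :=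
    (intervalIntegrable_iff_integrableOn_Icc_of_le zero_le_one).2 hsq
  have h3 : ∫ s in (0:ℝ)..1, (2 * c * g s - 1) ≤ ∫ s in (0:ℝ)..1, (g s)^2 := by
    apply intervalIntegral.integral_mono_on zero_le_one _ h2
    · intro x _
      nlinarith [sq_nonneg (g x - c)]
    · exact (h1.const_mul _).sub intervalIntegrable_const
  rw [intervalIntegral.integral_sub (h1.const_mul _) intervalIntegrable_const,
    intervalIntegral.integral_const_mul, hint] at h3
  simp at h3
  nlinarith

/-- Variational estimate for the two-delta symmetry breaking: for noise
corridors `γ₁, γ₂` from `−1` and `+1` to `0` with velocities `g₁, g₂`, masses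
`m₋, m₊` and merge time `s_m`, the moment functional is at most `m³/24 − m/2`,
strictly unless `m₋ = 0`, `m₊ = 0`, or `s_m = 1`. -/
theorem stmt_10 (mminus mplus : ℝ) (hminus : 0 ≤ mminus) (hplus : 0 ≤ mplus)
    (m : ℝ) (hm : m = mminus + mplus)
    (g₁ g₂ : ℝ → ℝ) (hg₁meas : Measurable g₁) (hg₂meas : Measurable g₂)
    (hg₁sq : IntegrableOn (fun s => (g₁ s)^2) (Set.Icc 0 1))
    (hg₂sq : IntegrableOn (fun s => (g₂ s)^2) (Set.Icc 0 1))
    (hg₁int : (∫ s in (0:ℝ)..1, g₁ s) = 1)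
    (hg₂int : (∫ s in (0:ℝ)..1, g₂ s) = -1)
    (γ₁ γ₂ : ℝ → ℝ)
    (hγ₁ : ∀ s : ℝ, γ₁ s = -1 + ∫ τ in (0:ℝ)..s, g₁ τ)
    (hγ₂ : ∀ s : ℝ, γ₂ s = 1 + ∫ τ in (0:ℝ)..s, g₂ τ)
    (sm : ℝ) (hsm : sm ∈ Set.Icc (0:ℝ) 1)
    (hmerge : ∀ s ∈ Set.Icc sm 1, γ₁ s = γ₂ s) :
    (1/24) * ((1 - sm) * (mminus^3 + mplus^3) + sm * m^3)
        - (mminus/2) * (∫ s in (0:ℝ)..1, (g₁ s)^2)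
        - (mplus/2) * (∫ s in (0:ℝ)..1, (g₂ s)^2) ≤ m^3/24 - m/2 ∧
    (0 < mminus → 0 < mplus → sm < 1 →
      (1/24) * ((1 - sm) * (mminus^3 + mplus^3) + sm * m^3)
          - (mminus/2) * (∫ s in (0:ℝ)..1, (g₁ s)^2)
          - (mplus/2) * (∫ s in (0:ℝ)..1, (g₂ s)^2) < m^3/24 - m/2) := by
  have e1 := energy_ge g₁ 1 (by norm_num) hg₁sq hg₁int
  have e2 := energy_ge g₂ (-1) (by norm_num) hg₂sq hg₂int
  have k1 := mul_nonneg hminus (sub_nonneg.2 e1)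
  have k2 := mul_nonneg hplus (sub_nonneg.2 e2)
  have hs : 0 ≤ 1 - sm := sub_nonneg.2 hsm.2
  subst hm
  constructor
  · have k3 : 0 ≤ (1 - sm) * (mminus * mplus * (mminus + mplus)) := by positivity
    linarith
  · intro a b c
    have hs' : 0 < 1 - sm := sub_pos.2 c
    have k3 : 0 < (1 - sm) * (mminus * mplus * (mminus + mplus)) := by positivity
    linarith
end

section
/- For every R ≥ 1 and γ ≥ 1 there exists c > 0 (depending only on R and γ) with the following property. For all reals N, T > 0 with N²T ≥ 1, all u ≥ 1, all 0 ≤ t₀ < t₁ < t₂ ≤ 1 satisfying t₁ − t₀ = min{ 1/R, (t₂ − t₁)^{6/13} + |x₂ − x₁|^{6/7} }, all x₁, x₂ ∈ [−R, R], and all x ∈ ℝ with |x| ≤ γ·√u, one has hk(T·(t₁ − t₀), N·T·(x₁ − x)) / hk(T·(t₂ − t₀), N·T·(x₂ − x)) ≤ exp( c·N²T·u·( (t₂ − t₁)^{1/13} + |x₂ − x₁|^{1/7} ) ). -/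
set_option maxHeartbeats 1000000

/-- The heat kernel `hk(s,y) = (2πs)^{−1/2}·exp(−y²/(2s))`. -/
noncomputable def hk (s y : ℝ) : ℝ := Real.exp (-y^2/(2*s)) / Real.sqrt (2*Real.pi*s)

/-- The heat-kernel ratio bound used in the continuity estimate: with
`t₁ − t₀ = min{1/R, (t₂−t₁)^{6/13} + |x₂−x₁|^{6/7}}`, the ratio
`hk(T(t₁−t₀), NT(x₁−x)) / hk(T(t₂−t₀), NT(x₂−x))` is at most
`exp(c·N²T·u·((t₂−t₁)^{1/13} + |x₂−x₁|^{1/7}))`. -/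
theorem stmt_11 :
    ∀ R : ℝ, 1 ≤ R → ∀ γ : ℝ, 1 ≤ γ → ∃ c : ℝ, 0 < c ∧
      ∀ N T u t₀ t₁ t₂ x₁ x₂ x : ℝ,
        0 < N → 0 < T → 1 ≤ N^2 * T → 1 ≤ u →
        0 ≤ t₀ → t₀ < t₁ → t₁ < t₂ → t₂ ≤ 1 →
        t₁ - t₀ = min (1/R) ((t₂ - t₁) ^ ((6:ℝ)/13) + |x₂ - x₁| ^ ((6:ℝ)/7)) →
        x₁ ∈ Set.Icc (-R) R → x₂ ∈ Set.Icc (-R) R →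
        |x| ≤ γ * Real.sqrt u →
        hk (T*(t₁ - t₀)) (N*T*(x₁ - x)) / hk (T*(t₂ - t₀)) (N*T*(x₂ - x)) ≤
          Real.exp (c * N^2 * T * u *
            ((t₂ - t₁) ^ ((1:ℝ)/13) + |x₂ - x₁| ^ ((1:ℝ)/7))) := by
  intro R hR γ hγ
  refine ⟨R + 2 * (R + γ) * R^2, by positivity, ?_⟩
  intro N T u t₀ t₁ t₂ x₁ x₂ x hN hT hNT hu h0 h01 h12 h2 hmin hx1 hx2 hx
  obtain ⟨a, ha⟩ : ∃ a, a = t₁ - t₀ := ⟨_, rfl⟩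
  obtain ⟨d, hd⟩ : ∃ d, d = t₂ - t₁ := ⟨_, rfl⟩
  obtain ⟨h, hh⟩ : ∃ h, h = |x₂ - x₁| := ⟨_, rfl⟩
  have hb : t₂ - t₀ = a + d := by rw [ha, hd]; ring
  rw [hb]
  rw [← ha, ← hd, ← hh] at hmin
  rw [← ha, ← hd, ← hh]
  have hapos : 0 < a := by linarith
  have hdpos : 0 < d := by linarith
  have hd1 : d ≤ 1 := by linarith
  have hhn : 0 ≤ h := by rw [hh]; exact abs_nonneg _
  have hh2 : h ≤ 2 * R := by
    rw [hh, abs_le]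
    constructor <;> linarith [hx1.1, hx1.2, hx2.1, hx2.2]
  obtain ⟨p, hp⟩ : ∃ p, p = d ^ ((1:ℝ)/13) := ⟨_, rfl⟩
  obtain ⟨q, hq⟩ : ∃ q, q = h ^ ((1:ℝ)/7) := ⟨_, rfl⟩
  have hp0 : 0 ≤ p := by rw [hp]; positivity
  have hq0 : 0 ≤ q := by rw [hq]; positivity
  have hp1 : p ≤ 1 := by rw [hp]; exact Real.rpow_le_one hdpos.le hd1 (by norm_num)
  have hp13 : d = p ^ 13 := by
    rw [hp, ← Real.rpow_natCast, ← Real.rpow_mul hdpos.le]; norm_num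
  have hp6 : d ^ ((6:ℝ)/13) = p ^ 6 := by
    rw [hp, ← Real.rpow_natCast, ← Real.rpow_mul hdpos.le]; norm_num
  have hq7 : h = q ^ 7 := by
    rw [hq, ← Real.rpow_natCast, ← Real.rpow_mul hhn]; norm_num
  have hq6 : h ^ ((6:ℝ)/7) = q ^ 6 := by
    rw [hq, ← Real.rpow_natCast, ← Real.rpow_mul hhn]; norm_num
  rw [← hp, ← hq]
  rw [hp6, hq6] at hmin
  have hq62 : q ^ 6 ≤ 2 * R := by
    rcases le_total q 1 with h1 | h1
    · have : q ^ 6 ≤ 1 := pow_le_one₀ hq0 h1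
      linarith
    · have : q ^ 6 ≤ q ^ 7 := pow_le_pow_right₀ h1 (by norm_num)
      linarith
  have hp6n : 0 ≤ p ^ 6 := by positivity
  have hq6n : 0 ≤ q ^ 6 := by positivity
  have key : p ^ 12 ≤ R * a ∧ q ^ 6 ≤ 2 * R ^ 2 * a := by
    rcases min_choice (1/R) (p ^ 6 + q ^ 6) with h1 | h1
    · rw [h1] at hmin
      have hRa : R * a = 1 := by rw [hmin]; field_simp
      have e : 2 * R ^ 2 * a = 2 * R := by
        calc 2 * R ^ 2 * a = 2 * R * (R * a) := by ring
          _ = _ := by rw [hRa]; ring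
      rw [hRa, e]
      exact ⟨pow_le_one₀ hp0 hp1, hq62⟩
    · rw [h1] at hmin
      have h12' : p ^ 12 ≤ p ^ 6 := pow_le_pow_of_le_one hp0 hp1 (by norm_num)
      constructor
      · nlinarith
      · nlinarith [mul_nonneg (sub_nonneg.2 hR) hapos.le]
  have kd : d ≤ R * p * a := by
    calc d = p * p ^ 12 := by rw [hp13]; ring
      _ ≤ p * (R * a) := mul_le_mul_of_nonneg_left key.1 hp0
      _ = _ := by ring
  have kh : h ≤ 2 * R ^ 2 * q * a := by
    calc h = q * q ^ 6 := by rw [hq7]; ring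
      _ ≤ q * (2 * R ^ 2 * a) := mul_le_mul_of_nonneg_left key.2 hq0
      _ = _ := by ring
  -- spatial part
  have hsu : Real.sqrt u ≤ u := by
    rw [Real.sqrt_le_left (by linarith)]; nlinarith
  have hxu : |x| ≤ γ * u := hx.trans (mul_le_mul_of_nonneg_left hsu (by linarith))
  have hRu : R ≤ R * u := by nlinarith
  have hx1' : |x₁| ≤ R := abs_le.2 hx1
  have hx2' : |x₂| ≤ R := abs_le.2 hx2
  have hy : |(x₂ - x) + (x₁ - x)| ≤ 2 * (R + γ) * u := by
    rw [abs_le] at *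
    constructor <;> linarith [hxu.1, hxu.2, hx1'.1, hx1'.2, hx2'.1, hx2'.2]
  have hsq : (x₂ - x)^2 - (x₁ - x)^2 ≤ 2 * (R + γ) * u * h := by
    calc (x₂ - x)^2 - (x₁ - x)^2 = ((x₂ - x) + (x₁ - x)) * (x₂ - x₁) := by ring
      _ ≤ |((x₂ - x) + (x₁ - x)) * (x₂ - x₁)| := le_abs_self _
      _ = |(x₂ - x) + (x₁ - x)| * h := by rw [abs_mul, ← hh]
      _ ≤ _ := mul_le_mul_of_nonneg_right hy hhn
  have hS : (x₂ - x)^2 / (a + d) - (x₁ - x)^2 / a ≤ 2 * (R + γ) * u * (2 * R ^ 2 * q) := by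
    have e1 : (x₁ - x)^2 / (a + d) ≤ (x₁ - x)^2 / a := by
      apply div_le_div_of_nonneg_left (sq_nonneg _) hapos; linarith
    have e2 : ((x₂ - x)^2 - (x₁ - x)^2) / (a + d) ≤ 2 * (R + γ) * u * (2 * R ^ 2 * q) := by
      rw [div_le_iff₀ (by linarith)]
      calc _ ≤ 2 * (R + γ) * u * h := hsq
        _ ≤ 2 * (R + γ) * u * (2 * R ^ 2 * q * a) :=
          mul_le_mul_of_nonneg_left kh (by positivity)
        _ ≤ 2 * (R + γ) * u * (2 * R ^ 2 * q * (a + d)) :=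
          mul_le_mul_of_nonneg_left
            (mul_le_mul_of_nonneg_left (by linarith) (by positivity)) (by positivity)
        _ = _ := by ring
    rw [sub_div] at e2
    linarith
  -- prefactor
  have hpre : Real.sqrt (2*Real.pi*(T*(a+d))) ≤
      Real.exp (R * p) * Real.sqrt (2*Real.pi*(T*a)) := by
    rw [Real.sqrt_le_left (by positivity), mul_pow, Real.sq_sqrt (by positivity)]
    have e1 : 1 + R * p ≤ Real.exp (R * p) ^ 2 := by
      have f1 := Real.add_one_le_exp (R * p)
      have f2 : 0 ≤ R * p := by positivity
      have f3 : Real.exp (R * p) ≤ Real.exp (R * p) ^ 2 :=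
        le_self_pow₀ (by linarith) (by norm_num)
      linarith
    calc 2*Real.pi*(T*(a+d)) ≤ 2*Real.pi*(T*((1 + R * p) * a)) := by
          gcongr; linarith
      _ = (1 + R * p) * (2*Real.pi*(T*a)) := by ring
      _ ≤ _ := mul_le_mul_of_nonneg_right e1 (by positivity)
  have hs1 : 0 < Real.sqrt (2*Real.pi*(T*a)) := Real.sqrt_pos.2 (by positivity)
  have hs2 : 0 < Real.sqrt (2*Real.pi*(T*(a+d))) := Real.sqrt_pos.2 (by positivity)
  have hexp : -(N*T*(x₁ - x))^2/(2*(T*a)) =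
      N^2*T/2*((x₂ - x)^2 / (a + d) - (x₁ - x)^2 / a)
        + -(N*T*(x₂ - x))^2/(2*(T*(a+d))) := by
    have : a + d ≠ 0 := by positivity
    field_simp
    ring
  have hM : 0 < N^2*T := by positivity
  have hfin : N^2*T/2*((x₂ - x)^2 / (a + d) - (x₁ - x)^2 / a) + R * p ≤
      (R + 2 * (R + γ) * R^2) * N^2 * T * u * (p + q) := by
    have e1 : N^2*T/2*((x₂ - x)^2 / (a + d) - (x₁ - x)^2 / a) ≤
        N^2*T/2*(2 * (R + γ) * u * (2 * R ^ 2 * q)) :=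
      mul_le_mul_of_nonneg_left hS (by positivity)
    have hMu : 1 ≤ N^2*T*u := one_le_mul_of_one_le_of_one_le hNT hu
    have e2 : R * p ≤ N^2*T*u * (R * p) := le_mul_of_one_le_left (by positivity) hMu
    have e3 : 0 ≤ N^2*T*u * (R * q) := by positivity
    have e4 : 0 ≤ N^2*T*u * (2 * (R + γ) * R^2 * p) := by positivity
    linarith
  unfold hk
  rw [div_le_iff₀ (by positivity), div_le_iff₀ hs1, hexp, Real.exp_add]
  calc _ ≤ Real.exp (N^2*T/2*((x₂ - x)^2 / (a + d) - (x₁ - x)^2 / a))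
          * Real.exp (-(N*T*(x₂ - x))^2/(2*(T*(a+d))))
          * (Real.exp (R * p) * Real.sqrt (2*Real.pi*(T*a)) / Real.sqrt (2*Real.pi*(T*(a+d)))) := by
        apply le_mul_of_one_le_right (by positivity)
        rw [le_div_iff₀ hs2, one_mul]; exact hpre
    _ = Real.exp (N^2*T/2*((x₂ - x)^2 / (a + d) - (x₁ - x)^2 / a) + R * p)
          * (Real.exp (-(N*T*(x₂ - x))^2/(2*(T*(a+d)))) / Real.sqrt (2*Real.pi*(T*(a+d))))
          * Real.sqrt (2*Real.pi*(T*a)) := by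
        rw [Real.exp_add]; ring
    _ ≤ _ := by
        gcongr
end
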